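/- arXiv:1308.3920 — 3 statements merged into one kernel-verified Lean document; each statement's English description precedes it below -/
import Mathlib

section
/- For every integer d ≥ 0, the dimension of the space V_d^{2T} of 2T-invariant homogeneous polynomials of degree d equals: 0 if d is odd; ⌊d/12⌋ + 1 if d ≡ 0, 6, or 8 (mod 12); and ⌊d/12⌋ if d ≡ 2, 4, or 10 (mod 12). -/
open Matrix

/-- The substitution action of a (invertible) `2×2` matrix `g` on polynomials in two
variables: `(g · f)(v) = f (g⁻¹ v)`. -/
noncomputable def mact (A : Matrix (Fin 2) (Fin 2) ℂ) :
    MvPolynomial (Fin 2) ℂ →ₐ[ℂ] MvPolynomial (Fin 2) ℂ :=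
  MvPolynomial.aeval fun i => ∑ j, A⁻¹ i j • MvPolynomial.X j

/-- `V_d^S`: the space of homogeneous polynomials of degree `d` in two variables invariant
under (the substitution action of) every matrix in `S`. -/
noncomputable def invariants (S : Set (Matrix (Fin 2) (Fin 2) ℂ)) (d : ℕ) :
    Submodule ℂ (MvPolynomial (Fin 2) ℂ) :=
  (MvPolynomial.homogeneousSubmodule (Fin 2) ℂ d) ⊓
    ⨅ A ∈ S, LinearMap.eqLocus (mact A).toLinearMap LinearMap.id

/-- The quaternion matrix `I = [[i,0],[0,−i]]`. -/
noncomputable def Iq : Matrix (Fin 2) (Fin 2) ℂ := !![Complex.I, 0; 0, -Complex.I]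

/-- The quaternion matrix `J = [[0,−1],[1,0]]`. -/
def Jq : Matrix (Fin 2) (Fin 2) ℂ := !![0, -1; 1, 0]

/-- The quaternion matrix `K = I·J`. -/
noncomputable def Kq : Matrix (Fin 2) (Fin 2) ℂ := Iq * Jq

/-- The binary tetrahedral group `2T ⊆ SL₂(ℂ)`, as a set of 24 matrices:
`±1, ±I, ±J, ±K` and `(±1 ± I ± J ± K)/2`. -/
noncomputable def binTet : Set (Matrix (Fin 2) (Fin 2) ℂ) :=
  {1, -1, Iq, -Iq, Jq, -Jq, Kq, -Kq} ∪
    { M | ∃ a ∈ ({1, -1} : Set ℂ), ∃ b ∈ ({1, -1} : Set ℂ), ∃ c ∈ ({1, -1} : Set ℂ),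
        ∃ e ∈ ({1, -1} : Set ℂ),
        M = (2 : ℂ)⁻¹ • (a • (1 : Matrix (Fin 2) (Fin 2) ℂ) + b • Iq + c • Jq + e • Kq) }

namespace BT

open MvPolynomial

lemma eval_mact (A : Matrix (Fin 2) (Fin 2) ℂ) (f : MvPolynomial (Fin 2) ℂ) (v : Fin 2 → ℂ) :
    eval v (mact A f) = eval (A⁻¹ *ᵥ v) f := by
  unfold mact
  rw [aeval_def, eval₂_eq', map_sum, eval_eq' (A⁻¹ *ᵥ v)]
  refine Finset.sum_congr rfl fun m _ => ?_
  simp [Matrix.mulVec, dotProduct, smul_eval]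

/-- invariance under one matrix, as functions -/
def Fx (f : MvPolynomial (Fin 2) ℂ) (A : Matrix (Fin 2) (Fin 2) ℂ) : Prop :=
  ∀ v, eval (A⁻¹ *ᵥ v) f = eval v f

lemma fx_iff (f : MvPolynomial (Fin 2) ℂ) (A : Matrix (Fin 2) (Fin 2) ℂ) :
    mact A f = f ↔ Fx f A := by
  constructor
  · intro h v
    rw [← eval_mact, h]
  · intro h
    apply MvPolynomial.funext
    intro v
    rw [eval_mact, h v]

lemma mem_inv {S : Set (Matrix (Fin 2) (Fin 2) ℂ)} {d : ℕ} {f : MvPolynomial (Fin 2) ℂ} :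
    f ∈ invariants S d ↔ f.IsHomogeneous d ∧ ∀ A ∈ S, Fx f A := by
  simp [invariants, Submodule.mem_iInf, ← fx_iff, mem_homogeneousSubmodule]

lemma Fx.mul {f A B} (hA : Fx f A) (hB : Fx f B) : Fx f (A * B) := by
  intro v
  rw [Matrix.mul_inv_rev, ← Matrix.mulVec_mulVec, hB, hA]

/-- the element `ω` -/
noncomputable def Om : Matrix (Fin 2) (Fin 2) ℂ :=
  (2 : ℂ)⁻¹ • ((1 : Matrix (Fin 2) (Fin 2) ℂ) + Iq + Jq + Kq)

lemma II : Complex.I * Complex.I = -1 := Complex.I_mul_I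

lemma mext {A B : Matrix (Fin 2) (Fin 2) ℂ} (h1 : A 0 0 = B 0 0) (h2 : A 0 1 = B 0 1)
    (h3 : A 1 0 = B 1 0) (h4 : A 1 1 = B 1 1) : A = B := by
  ext i j; fin_cases i <;> fin_cases j <;> assumption

/-- general element -/
noncomputable def Wq (a b c e : ℂ) : Matrix (Fin 2) (Fin 2) ℂ :=
  (2 : ℂ)⁻¹ • (a • (1 : Matrix (Fin 2) (Fin 2) ℂ) + b • Iq + c • Jq + e • Kq)

lemma Wq_eq (a b c e : ℂ) : Wq a b c e =
    !![(a + b * Complex.I)/2, (-c - e * Complex.I)/2; (c - e * Complex.I)/2,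
      (a - b * Complex.I)/2] := by
  apply mext <;> simp [Wq, Iq, Jq, Kq] <;> ring

lemma I_mul_W (a b c e : ℂ) : Iq * Wq a b c e = Wq (-b) a (-e) c := by
  have := II
  rw [Wq_eq, Wq_eq]
  apply mext <;> simp [Iq] <;> grind

lemma J_mul_W (a b c e : ℂ) : Jq * Wq a b c e = Wq (-c) e a (-b) := by
  have := II
  rw [Wq_eq, Wq_eq]
  apply mext <;> simp [Jq] <;> grind

lemma om_sq : Om * Om = Wq (-1) 1 1 1 := by
  have h : Om = Wq 1 1 1 1 := by simp [Wq, Om]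
  have := II
  rw [h, Wq_eq, Wq_eq]
  apply mext <;> simp <;> grind

lemma gen {f} (hI : Fx f Iq) (hJ : Fx f Jq) (hO : Fx f Om) : ∀ A ∈ binTet, Fx f A := by
  have h1 : Fx f 1 := by intro v; simp
  have hm : Fx f (-1) := by
    have := hJ.mul hJ
    convert this using 1
    ext i j; fin_cases i <;> fin_cases j <;> simp [Jq]
  have hK : Fx f Kq := hI.mul hJ
  have neg : ∀ A, Fx f A → Fx f (-A) := by
    intro A hA
    simpa using hm.mul hA
  intro A hA
  rcases hA with hA | ⟨a, ha, b, hb, c, hc, e, he, rfl⟩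
  · simp only [Set.mem_insert_iff, Set.mem_singleton_iff] at hA
    rcases hA with rfl | rfl | rfl | rfl | rfl | rfl | rfl | rfl
    · exact h1
    · exact hm
    · exact hI
    · exact neg _ hI
    · exact hJ
    · exact neg _ hJ
    · exact hK
    · exact neg _ hK
  · simp only [Set.mem_insert_iff, Set.mem_singleton_iff] at ha hb hc he
    have w1 : Fx f (Wq 1 1 1 1) := by simpa [Wq, Om] using hO
    have w2 : Fx f (Wq (-1) 1 1 1) := by rw [← om_sq]; exact hO.mul hO
    have rI : ∀ {a b c e}, Fx f (Wq a b c e) → Fx f (Wq (-b) a (-e) c) := by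
      intro a b c e h
      rw [← I_mul_W]
      exact hI.mul h
    have rJ : ∀ {a b c e}, Fx f (Wq a b c e) → Fx f (Wq (-c) e a (-b)) := by
      intro a b c e h
      rw [← J_mul_W]
      exact hJ.mul h
    have key : ∀ {a b c e}, Fx f (Wq a b c e) → Fx f (Wq (-a) (-b) (-c) (-e)) := by
      intro a b c e h
      exact rI (rI h)
    have i1 := rI w1
    have j1 := rJ w1
    have k1 := rJ i1
    have i2 := rI w2
    have j2 := rJ w2
    have k2 := rJ i2
    have n1 := key w1
    have n2 := key w2
    have ni1 := key i1
    have nj1 := key j1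
    have nk1 := key k1
    have ni2 := key i2
    have nj2 := key j2
    have nk2 := key k2
    simp only [neg_neg] at *
    change Fx f (Wq a b c e)
    rcases ha with rfl | rfl <;> rcases hb with rfl | rfl <;> rcases hc with rfl | rfl <;>
      rcases he with rfl | rfl <;> with_reducible assumption

lemma invI : Iq⁻¹ = !![-Complex.I, 0; 0, Complex.I] := by
  apply Matrix.inv_eq_right_inv
  ext i j; fin_cases i <;> fin_cases j <;> simp [Iq]

lemma invJ : Jq⁻¹ = !![0, 1; -1, 0] := by
  apply Matrix.inv_eq_right_inv
  ext i j; fin_cases i <;> fin_cases j <;> simp [Jq]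

lemma invQ (c e : ℂ) (hc : c * c = 1) (he : e * e = 1) :
    ((2 : ℂ)⁻¹ • ((1 : Matrix (Fin 2) (Fin 2) ℂ) + Iq + c • Jq + e • Kq))⁻¹ =
    !![(1 - Complex.I)/2, (c + e * Complex.I)/2; (-c + e * Complex.I)/2, (1+Complex.I)/2] := by
  have := II
  apply Matrix.inv_eq_right_inv
  ext i j; fin_cases i <;> fin_cases j <;> simp [Iq, Jq, Kq, Matrix.mul_apply, Fin.sum_univ_two] <;> grind

lemma invO : Om⁻¹ = !![(1 - Complex.I)/2, (1 + Complex.I)/2; (-1 + Complex.I)/2, (1+Complex.I)/2] := by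
  have := invQ 1 1 (by simp) (by simp)
  simpa [Om] using this

noncomputable def f6 : MvPolynomial (Fin 2) ℂ := X 0 * X 1 * (X 1 ^ 4 - X 0 ^ 4)
noncomputable def f8 : MvPolynomial (Fin 2) ℂ := X 0 ^ 8 + C 14 * (X 0 ^ 4 * X 1 ^ 4) + X 1 ^ 8
noncomputable def f12 : MvPolynomial (Fin 2) ℂ :=
  X 0 ^ 12 + C (-33) * (X 0 ^ 8 * X 1 ^ 4) + C (-33) * (X 0 ^ 4 * X 1 ^ 8) + X 1 ^ 12

lemma f6_hom : f6.IsHomogeneous 6 := by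
  have h0 := isHomogeneous_X_pow (R := ℂ) (0 : Fin 2) 4
  have h1 := isHomogeneous_X_pow (R := ℂ) (1 : Fin 2) 4
  exact ((isHomogeneous_X ℂ 0).mul (isHomogeneous_X ℂ 1)).mul (h1.sub h0)

lemma f8_hom : f8.IsHomogeneous 8 := by
  have h0 := fun n => isHomogeneous_X_pow (R := ℂ) (0 : Fin 2) n
  have h1 := fun n => isHomogeneous_X_pow (R := ℂ) (1 : Fin 2) n
  exact ((h0 8).add (((h0 4).mul (h1 4)).C_mul _)).add (h1 8)

lemma f12_hom : f12.IsHomogeneous 12 := by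
  have h0 := fun n => isHomogeneous_X_pow (R := ℂ) (0 : Fin 2) n
  have h1 := fun n => isHomogeneous_X_pow (R := ℂ) (1 : Fin 2) n
  exact (((h0 12).add (((h0 8).mul (h1 4)).C_mul _)).add (((h0 4).mul (h1 8)).C_mul _)).add (h1 12)

lemma I2 : Complex.I ^ 2 = -1 := Complex.I_sq
lemma I4 : Complex.I ^ 4 = 1 := Complex.I_pow_four

lemma om_vec (v : Fin 2 → ℂ) : Om⁻¹ *ᵥ v =
   ![(1 - Complex.I)/2 * (v 0 + Complex.I * v 1), (1 - Complex.I)/2 * (-v 0 + Complex.I * v 1)] := by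
  have := II
  rw [invO]
  ext i; fin_cases i <;> simp [Matrix.mulVec, dotProduct, Fin.sum_univ_two] <;> grind

lemma s4 : ((1 - Complex.I)/2)^4 = -1/4 := by
  have := I2
  grind

lemma f6_inv : f6 ∈ invariants binTet 6 := by
  refine mem_inv.2 ⟨f6_hom, gen ?_ ?_ ?_⟩ <;> intro v
  · rw [invI]
    simp [f6, Matrix.mulVec, dotProduct, Fin.sum_univ_two, mul_pow]
    grind [I2]
  · rw [invJ]
    simp [f6, Matrix.mulVec, dotProduct, Fin.sum_univ_two]
    ring
  · rw [om_vec]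
    simp [f6]
    have := s4
    have := I2
    generalize Complex.I = t at *
    generalize v 0 = x at *
    generalize v 1 = y at *
    grind

lemma f8_inv : f8 ∈ invariants binTet 8 := by
  refine mem_inv.2 ⟨f8_hom, gen ?_ ?_ ?_⟩ <;> intro v
  · rw [invI]
    simp [f8, Matrix.mulVec, dotProduct, Fin.sum_univ_two, mul_pow]
    grind [I4]
  · rw [invJ]
    simp [f8, Matrix.mulVec, dotProduct, Fin.sum_univ_two]
    ring
  · rw [om_vec]
    simp [f8]
    have := s4
    have := I2
    generalize Complex.I = t at *
    generalize v 0 = x at *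
    generalize v 1 = y at *
    grind

lemma f12_inv : f12 ∈ invariants binTet 12 := by
  refine mem_inv.2 ⟨f12_hom, gen ?_ ?_ ?_⟩ <;> intro v
  · rw [invI]
    simp [f12, Matrix.mulVec, dotProduct, Fin.sum_univ_two, mul_pow]
    grind [I4]
  · rw [invJ]
    simp [f12, Matrix.mulVec, dotProduct, Fin.sum_univ_two]
    ring
  · rw [om_vec]
    simp [f12]
    have := s4
    have := I2
    generalize Complex.I = t at *
    generalize v 0 = x at *
    generalize v 1 = y at *
    grind

lemma f6_ne : f6 ≠ 0 := by
  intro h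
  have := congrArg (eval ![1, 2]) h
  norm_num [f6] at this


lemma dvd_hom {f P : MvPolynomial (Fin 2) ℂ} {d n : ℕ} (hf : f.IsHomogeneous d)
    (hP : P.IsHomogeneous n) (h : P ∣ f) :
    ∃ g, g.IsHomogeneous (d - n) ∧ f = P * g ∧ (d < n → f = 0) := by
  letI := MvPolynomial.gradedAlgebra (σ := Fin 2) (R := ℂ)
  obtain ⟨g, rfl⟩ := h
  have h1 := DirectSum.decompose_of_mem_same (homogeneousSubmodule (Fin 2) ℂ) hf
  by_cases hn : n ≤ d
  · refine ⟨_, (DirectSum.decompose (homogeneousSubmodule (Fin 2) ℂ) g (d - n)).2, ?_, by omega⟩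
    rw [← DirectSum.coe_decompose_mul_of_left_mem_of_le (homogeneousSubmodule (Fin 2) ℂ) hP hn, h1]
  · rw [DirectSum.coe_decompose_mul_of_left_mem_of_not_le (homogeneousSubmodule (Fin 2) ℂ) hP hn]
      at h1
    exact ⟨0, isHomogeneous_zero _ _ _, by rw [← h1]; simp, fun _ => h1.symm⟩

lemma eval_hom {f : MvPolynomial (Fin 2) ℂ} {d : ℕ} (hf : f.IsHomogeneous d) (s : ℂ)
    (v : Fin 2 → ℂ) : eval (fun i => v i * s) f = s ^ d * eval v f := by
  rw [eval_eq', eval_eq', Finset.mul_sum]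
  refine Finset.sum_congr rfl fun m hm => ?_
  have : m 0 + m 1 = d := by
    have := hf.degree_eq_sum_deg_support hm
    rw [this, ← Finsupp.degree_apply, Finsupp.degree_eq_sum]; simp
  simp [Fin.prod_univ_two, ← this]
  ring

lemma dvd_lin {f l : MvPolynomial (Fin 2) ℂ} {d : ℕ} (hf : f.IsHomogeneous d) (p : Fin 2 → ℂ)
    (k : Fin 2) (hl : ∀ i, l ∣ X i - C (p i) * X k) (h0 : eval p f = 0) : l ∣ f := by
  have e1 : aeval (fun i => C (p i) * X k) f = (0 : MvPolynomial (Fin 2) ℂ) := by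
    apply MvPolynomial.funext
    intro v
    have := eval_hom hf (v k) p
    rw [h0, mul_zero] at this
    rw [map_zero, ← this, aeval_def, eval₂_eq', map_sum, eval_eq' (fun i => p i * v k)]
    refine Finset.sum_congr rfl fun m _ => ?_
    simp
  have e2 : (Ideal.Quotient.mkₐ ℂ (Ideal.span {l})).comp (aeval (fun i => C (p i) * X k)) =
      Ideal.Quotient.mkₐ ℂ (Ideal.span {l}) := by
    apply MvPolynomial.algHom_ext
    intro i
    rw [AlgHom.comp_apply, aeval_X]
    symm
    exact Ideal.Quotient.eq.2 (Ideal.mem_span_singleton.2 (hl i))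
  have e3 := DFunLike.congr_fun e2 f
  rw [AlgHom.comp_apply, e1, map_zero] at e3
  exact Ideal.mem_span_singleton.1 (Ideal.Quotient.eq_zero_iff_mem.1 e3.symm)

lemma step {f : MvPolynomial (Fin 2) ℂ} {d : ℕ} (hf : f.IsHomogeneous d) (z : ℂ)
    (h0 : eval ![1, z] f = 0) : ∃ g, g.IsHomogeneous (d - 1) ∧ f = (X 1 - C z * X 0) * g := by
  have : (X 1 - C z * X 0 : MvPolynomial (Fin 2) ℂ).IsHomogeneous 1 :=
    (isHomogeneous_X ℂ 1).sub ((isHomogeneous_X ℂ 0).C_mul z)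
  obtain ⟨g, h1, h2, -⟩ := dvd_hom hf this (dvd_lin hf ![1, z] 0 (by
    intro i; fin_cases i <;> simp) h0)
  exact ⟨g, h1, h2⟩

lemma step' {f : MvPolynomial (Fin 2) ℂ} {d : ℕ} (hf : f.IsHomogeneous d)
    (h0 : eval ![0, 1] f = 0) : ∃ g, g.IsHomogeneous (d - 1) ∧ f = X 0 * g := by
  obtain ⟨g, h1, h2, -⟩ := dvd_hom hf (isHomogeneous_X ℂ 0) (dvd_lin hf ![0, 1] 1 (by
    intro i; fin_cases i <;> simp) h0)
  exact ⟨g, h1, h2⟩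

lemma step_eval {g : MvPolynomial (Fin 2) ℂ} {z w : ℂ} (hw : w ≠ z)
    (h : eval ![1, w] ((X 1 - C z * X 0) * g) = 0) : eval ![1, w] g = 0 := by
  simpa [sub_eq_zero, hw] using h

lemma f6_dvd {f : MvPolynomial (Fin 2) ℂ} {d : ℕ} (hf : f.IsHomogeneous d)
    (h : eval ![0, 1] f = 0) (h0 : eval ![1, 0] f = 0) (h1 : eval ![1, 1] f = 0)
    (h2 : eval ![1, -1] f = 0) (h3 : eval ![1, Complex.I] f = 0)
    (h4 : eval ![1, -Complex.I] f = 0) : f6 ∣ f := by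
  obtain ⟨g, hg, rfl⟩ := step' hf h
  have e : ∀ z : ℂ, eval ![1, z] (X 0 * g) = 0 → eval ![1, z] g = 0 := by
    intro z hz; simpa using hz
  replace h0 := e _ h0
  replace h1 := e _ h1
  replace h2 := e _ h2
  replace h3 := e _ h3
  replace h4 := e _ h4
  have i2 := I2
  obtain ⟨g0, hg0, rfl⟩ := step hg _ h0
  replace h1 := step_eval (by grind) h1
  replace h2 := step_eval (by grind) h2
  replace h3 := step_eval (by grind) h3
  replace h4 := step_eval (by grind) h4
  obtain ⟨g1, hg1, rfl⟩ := step hg0 _ h1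
  replace h2 := step_eval (by grind) h2
  replace h3 := step_eval (by grind) h3
  replace h4 := step_eval (by grind) h4
  obtain ⟨g2, hg2, rfl⟩ := step hg1 _ h2
  replace h3 := step_eval (by grind) h3
  replace h4 := step_eval (by grind) h4
  obtain ⟨g3, hg3, rfl⟩ := step hg2 _ h3
  replace h4 := step_eval (by grind) h4
  obtain ⟨g4, hg4, rfl⟩ := step hg3 _ h4
  refine ⟨g4, ?_⟩
  have ci : (C Complex.I : MvPolynomial (Fin 2) ℂ) ^ 2 = -1 := by
    rw [← C_pow, i2]; simp
  unfold f6
  simp only [map_zero, map_one, map_neg]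
  linear_combination (- X 0 * X 1 * (X 1 ^ 2 - X 0 ^ 2) * X 0 ^ 2 * g4) * ci

lemma val_z {f : MvPolynomial (Fin 2) ℂ} {d : ℕ} (hf : f ∈ invariants binTet d) (z c e : ℂ)
    (hc : c = 1 ∨ c = -1) (he : e = 1 ∨ e = -1)
    (hz : (-c + e * Complex.I) / 2 = z * ((1 - Complex.I) / 2)) :
    eval ![1, 0] f = ((1 - Complex.I) / 2) ^ d * eval ![1, z] f := by
  obtain ⟨h1, h2⟩ := mem_inv.1 hf
  have := h2 ((2 : ℂ)⁻¹ • ((1 : Matrix (Fin 2) (Fin 2) ℂ) + Iq + c • Jq + e • Kq))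
    (Or.inr ⟨1, by simp, 1, by simp, c, by simpa using hc, e, by simpa using he, by simp⟩) ![1, 0]
  rw [← this, ← eval_hom h1, invQ _ _ (by rcases hc with rfl | rfl <;> simp)
    (by rcases he with rfl | rfl <;> simp)]
  congr 2
  ext i
  fin_cases i <;> simp [Matrix.mulVec, dotProduct, Fin.sum_univ_two, hz]

lemma vals {f : MvPolynomial (Fin 2) ℂ} {d : ℕ} (hf : f ∈ invariants binTet d) :
    (eval ![1, 0] f = ((1 - Complex.I) / 2) ^ d * eval ![1, 1] f ∧
    eval ![1, 0] f = ((1 - Complex.I) / 2) ^ d * eval ![1, -1] f) ∧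
    eval ![1, 0] f = ((1 - Complex.I) / 2) ^ d * eval ![1, Complex.I] f ∧
    eval ![1, 0] f = ((1 - Complex.I) / 2) ^ d * eval ![1, -Complex.I] f := by
  have := I2
  refine ⟨⟨val_z hf _ (-1) (-1) ?_ ?_ ?_, val_z hf _ 1 1 ?_ ?_ ?_⟩, val_z hf _ (-1) 1 ?_ ?_ ?_,
    val_z hf _ 1 (-1) ?_ ?_ ?_⟩ <;> first | (simp; done) | grind

lemma val_J {f : MvPolynomial (Fin 2) ℂ} {d : ℕ} (hf : f ∈ invariants binTet d) :
    eval ![1, 0] f = eval ![0, 1] f := by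
  obtain ⟨h1, h2⟩ := mem_inv.1 hf
  rw [← h2 Jq (Or.inl (by simp)) ![0, 1], invJ]
  congr 2
  ext i
  fin_cases i <;> simp [Matrix.mulVec, dotProduct, Fin.sum_univ_two]

lemma val_I {f : MvPolynomial (Fin 2) ℂ} {d : ℕ} (hf : f ∈ invariants binTet d) :
    eval ![1, 0] f = (- Complex.I) ^ d * eval ![1, 0] f := by
  obtain ⟨h1, h2⟩ := mem_inv.1 hf
  conv_lhs => rw [← h2 Iq (Or.inl (by simp)) ![1, 0], invI]
  rw [← eval_hom h1]
  congr 2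
  ext i
  fin_cases i <;> simp [Matrix.mulVec, dotProduct, Fin.sum_univ_two]

lemma ker_eq {f : MvPolynomial (Fin 2) ℂ} {d : ℕ} (hf : f ∈ invariants binTet d)
    (h0 : eval ![1, 0] f = 0) :
    ∃ g ∈ invariants binTet (d - 6), f = f6 * g ∧ (d < 6 → f = 0) := by
  obtain ⟨h1, h2⟩ := mem_inv.1 hf
  obtain ⟨⟨a1, a2⟩, a3, a4⟩ := vals hf
  have hn : ((1 - Complex.I) / 2) ^ d ≠ 0 := by
    apply pow_ne_zero
    have := I2
    grind
  have e : ∀ t : ℂ, eval ![1, 0] f = ((1 - Complex.I) / 2) ^ d * t → t = 0 := by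
    intro t ht
    rw [h0] at ht
    exact (mul_eq_zero.1 ht.symm).resolve_left hn
  obtain ⟨g, g1, g2, g3⟩ := dvd_hom h1 f6_hom (f6_dvd h1 ((val_J hf).symm.trans h0) h0
    (e _ a1) (e _ a2) (e _ a3) (e _ a4))
  refine ⟨g, mem_inv.2 ⟨g1, fun A hA => ?_⟩, g2, g3⟩
  have b1 := (fx_iff _ _).2 (h2 A hA)
  have b2 := (fx_iff _ _).2 ((mem_inv.1 f6_inv).2 A hA)
  rw [g2, map_mul, b2] at b1
  refine (fx_iff _ _).1 (mul_left_cancel₀ f6_ne b1)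

lemma inv_mul {f g : MvPolynomial (Fin 2) ℂ} {d e : ℕ} (hf : f ∈ invariants binTet d)
    (hg : g ∈ invariants binTet e) : f * g ∈ invariants binTet (d + e) := by
  rw [mem_inv] at *
  refine ⟨hf.1.mul hg.1, fun A hA v => ?_⟩
  rw [map_mul, map_mul, hf.2 A hA v, hg.2 A hA v]

lemma inv_one : (1 : MvPolynomial (Fin 2) ℂ) ∈ invariants binTet 0 :=
  mem_inv.2 ⟨isHomogeneous_one _ _, fun A hA v => by simp⟩

lemma inv_pow {f : MvPolynomial (Fin 2) ℂ} {d : ℕ} (hf : f ∈ invariants binTet d) (n : ℕ) :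
    f ^ n ∈ invariants binTet (d * n) := by
  induction n with
  | zero => simpa using inv_one
  | succ n ih => rw [pow_succ, mul_add, mul_one]; exact inv_mul ih hf

lemma exists_val {m : ℕ} (hm : m ≠ 1) : ∃ f ∈ invariants binTet (4 * m), eval ![1, 0] f = 1 := by
  obtain ⟨a, b, h⟩ : ∃ a b, 4 * m = 8 * a + 12 * b := by
    rcases Nat.even_or_odd' m with ⟨c, rfl | rfl⟩
    · exact ⟨c, 0, by ring⟩
    · exact ⟨c - 1, 1, by omega⟩
  refine ⟨f8 ^ a * f12 ^ b, ?_, ?_⟩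
  · rw [h]; exact inv_mul (inv_pow f8_inv a) (inv_pow f12_inv b)
  · simp [f8, f12]

lemma val_four {f : MvPolynomial (Fin 2) ℂ} (hf : f ∈ invariants binTet 4) :
    eval ![1, 0] f = 0 := by
  have i2 := I2
  obtain ⟨⟨a1, a2⟩, a3, a4⟩ := vals hf
  have h1 := (mem_inv.1 hf).1
  have key : eval ![1, 1] f + eval ![1, -1] f + eval ![1, Complex.I] f + eval ![1, -Complex.I] f
      = 4 * (eval ![1, 0] f + eval ![0, 1] f) := by
    simp only [eval_eq', ← Finset.sum_add_distrib, Finset.mul_sum]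
    refine Finset.sum_congr rfl fun m hm => ?_
    have : m 0 + m 1 = 4 := by
      have := h1.degree_eq_sum_deg_support hm
      rw [this, ← Finsupp.degree_apply, Finsupp.degree_eq_sum]; simp
    have h0 : m 0 = 4 - m 1 := by omega
    have h2 : m 1 ≤ 4 := by omega
    simp only [Fin.prod_univ_two, h0]
    generalize m 1 = k at *
    interval_cases k <;> simp <;> grind
  rw [s4] at *
  rw [← val_J hf] at key
  grind

lemma val_zero {f : MvPolynomial (Fin 2) ℂ} {d : ℕ} (hf : f ∈ invariants binTet d)
    (hd : d % 4 ≠ 0) : eval ![1, 0] f = 0 := by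
  have h := val_I hf
  have i2 := I2
  have e : (-Complex.I) ^ d = (-Complex.I) ^ (d % 4) := by
    conv_lhs => rw [← Nat.div_add_mod d 4, pow_add, pow_mul]
    have : (-Complex.I) ^ 4 = 1 := by grind
    rw [this]; simp
  rw [e] at h
  have : d % 4 < 4 := Nat.mod_lt _ (by norm_num)
  generalize d % 4 = k at *
  have c1 : (1 : ℂ) + Complex.I ≠ 0 := by grind
  have c2 : (1 : ℂ) - Complex.I ≠ 0 := by grind
  interval_cases k
  · exact absurd rfl hd
  · have : (1 + Complex.I) * eval ![1, 0] f = 0 := by linear_combination h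
    simpa [c1] using this
  · grind
  · have : (1 - Complex.I) * eval ![1, 0] f = 0 := by grind
    simpa [c2] using this

/-- evaluation at (1,0) -/
noncomputable def ev (d : ℕ) : invariants binTet d →ₗ[ℂ] ℂ :=
  (aeval ![(1 : ℂ), 0]).toLinearMap ∘ₗ (invariants binTet d).subtype

lemma ev_apply (d : ℕ) (f : invariants binTet d) : ev d f = eval ![1, 0] f.1 := by
  simp [ev, aeval_eq_eval]

noncomputable def mulf (d : ℕ) : invariants binTet d →ₗ[ℂ] invariants binTet (d + 6) :=
  LinearMap.codRestrict _ ((LinearMap.mulLeft ℂ f6) ∘ₗ (invariants binTet d).subtype)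
    (fun f => by
      have := inv_mul f6_inv f.2
      rw [add_comm] at this
      exact this)

lemma mulf_apply (d : ℕ) (f : invariants binTet d) : (mulf d f).1 = f6 * f.1 := rfl

lemma mulf_inj (d : ℕ) : Function.Injective (mulf d) := by
  intro f g h
  have := congrArg Subtype.val h
  rw [mulf_apply, mulf_apply] at this
  exact Subtype.ext (mul_left_cancel₀ f6_ne this)

lemma ker_ev (d : ℕ) : LinearMap.ker (ev (d + 6)) = LinearMap.range (mulf d) := by
  ext f
  rw [LinearMap.mem_ker, ev_apply, LinearMap.mem_range]
  constructor
  · intro h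
    obtain ⟨g, hg, e, -⟩ := ker_eq f.2 h
    exact ⟨⟨g, hg⟩, Subtype.ext e.symm⟩
  · rintro ⟨g, rfl⟩
    rw [mulf_apply]
    simp [f6]

lemma ker_small (d : ℕ) (hd : d < 6) : LinearMap.ker (ev d) = ⊥ := by
  rw [Submodule.eq_bot_iff]
  intro f hf
  rw [LinearMap.mem_ker, ev_apply] at hf
  obtain ⟨g, hg, e, h⟩ := ker_eq f.2 hf
  exact Subtype.ext (h hd)

lemma range_ev (d : ℕ) : Module.finrank ℂ (LinearMap.range (ev d)) =
    if d % 4 = 0 ∧ d ≠ 4 then 1 else 0 := by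
  split_ifs with h
  · obtain ⟨f, hf, h1⟩ := exists_val (m := d / 4) (by omega)
    rw [show 4 * (d / 4) = d by omega] at hf
    have : LinearMap.range (ev d) = ⊤ := by
      rw [LinearMap.range_eq_top]
      intro c
      refine ⟨c • ⟨f, hf⟩, ?_⟩
      rw [map_smul, ev_apply, h1]; simp
    rw [this]; simp
  · have : ev d = 0 := by
      ext f
      rw [ev_apply]
      by_cases h4 : d = 4
      · subst h4; exact val_four f.2
      · exact val_zero f.2 (by omega)
    rw [this]; simp

instance fin_inv (d : ℕ) : FiniteDimensional ℂ (invariants binTet d) := by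
  have : FiniteDimensional ℂ (homogeneousSubmodule (Fin 2) ℂ d) :=
    Module.Finite.iff_fg.2 (homogeneousSubmodule_fg _ _ d)
  exact Submodule.finiteDimensional_of_le (S₂ := homogeneousSubmodule (Fin 2) ℂ d) inf_le_left

lemma rec_small (d : ℕ) (hd : d < 6) : Module.finrank ℂ (invariants binTet d) =
    if d % 4 = 0 ∧ d ≠ 4 then 1 else 0 := by
  have := LinearMap.finrank_range_add_finrank_ker (ev d)
  rw [ker_small d hd, range_ev, finrank_bot, add_zero] at this
  exact this.symm

lemma rec_step (d : ℕ) : Module.finrank ℂ (invariants binTet (d + 6)) =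
    (if (d + 6) % 4 = 0 then 1 else 0) + Module.finrank ℂ (invariants binTet d) := by
  have := LinearMap.finrank_range_add_finrank_ker (ev (d + 6))
  rw [ker_ev, range_ev, LinearMap.finrank_range_of_inj (mulf_inj d)] at this
  rw [← this]
  simp

end BT

theorem statement7 (d : ℕ) :
    Module.finrank ℂ (invariants binTet d) =
      if d % 2 = 1 then 0
      else if d % 12 = 0 ∨ d % 12 = 6 ∨ d % 12 = 8 then d / 12 + 1
      else d / 12 := by
  induction d using Nat.strong_induction_on with
  | _ d ih =>
    by_cases hd : d < 6
    · rw [BT.rec_small d hd]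
      split_ifs <;> omega
    · obtain ⟨e, rfl⟩ : ∃ e, d = e + 6 := ⟨d - 6, by omega⟩
      rw [BT.rec_step, ih e (by omega)]
      split_ifs <;> omega
end

section
/- Let φ₁ := [[(1+i)/√2, 0],[0, (1−i)/√2]] ∈ GL₂(ℂ). Then φ₁ normalizes the binary tetrahedral group 2T, so the substitution action of φ₁ maps V_d^{2T} into itself; and for every integer d ≥ 0, the trace of φ₁ acting on V_d^{2T} equals 1 if d ≡ 0 (mod 8), equals −1 if d ≡ 6 (mod 8), and equals 0 otherwise. -/
open Matrix

/-- The matrix `φ₁ = [[(1+i)/√2, 0],[0,(1−i)/√2]]`. -/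
noncomputable def phi1 : Matrix (Fin 2) (Fin 2) ℂ :=
  !![(1 + Complex.I) / (Real.sqrt 2 : ℂ), 0; 0, (1 - Complex.I) / (Real.sqrt 2 : ℂ)]



/-! ### Matrix identities -/

noncomputable def om : Matrix (Fin 2) (Fin 2) ℂ :=
  (2 : ℂ)⁻¹ • !![1 + Complex.I, -(1 + Complex.I); 1 - Complex.I, 1 - Complex.I]

lemma Kq_eq : Kq = !![0, -Complex.I; -Complex.I, 0] := by
  simp [Kq, Iq, Jq]

lemma om_eq : om = (2 : ℂ)⁻¹ • ((1:ℂ) • (1 : Matrix (Fin 2) (Fin 2) ℂ) + (1:ℂ) • Iq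
    + (1:ℂ) • Jq + (1:ℂ) • Kq) := by
  rw [om, Kq_eq, Iq, Jq, Matrix.one_fin_two]
  ext i j
  fin_cases i <;> fin_cases j <;> simp <;> ring

lemma om_mul_I : om * Iq = Jq * om := by
  have h := Complex.I_mul_I
  ext i j
  fin_cases i <;> fin_cases j <;> simp [om, Iq, Jq] <;> grind

lemma om_mul_J : om * Jq = Kq * om := by
  have h := Complex.I_mul_I
  ext i j
  fin_cases i <;> fin_cases j <;> simp [om, Jq, Kq_eq] <;> grind

lemma om_mul_K : om * Kq = Iq * om := by
  have h := Complex.I_mul_I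
  ext i j
  fin_cases i <;> fin_cases j <;> simp [om, Iq, Kq_eq] <;> grind

lemma I_mul_I' : Iq * Iq = -1 := by
  rw [Iq, Matrix.one_fin_two]; simp

lemma J_mul_J' : Jq * Jq = -1 := by
  rw [Jq, Matrix.one_fin_two]; simp

lemma J_mul_I' : Jq * Iq = -Kq := by
  rw [Kq_eq, Jq, Iq]; simp

lemma om_cube : om * om * om = -1 := by
  have h := Complex.I_mul_I
  ext i j
  fin_cases i <;> fin_cases j <;> simp [om, Matrix.mul_apply, Fin.sum_univ_two] <;> grind

lemma sqrt2_sq : (Real.sqrt 2 : ℂ) * (Real.sqrt 2 : ℂ) = 2 := by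
  rw [← Complex.ofReal_mul, Real.mul_self_sqrt (by norm_num)]; norm_num

lemma sqrt2_ne : (Real.sqrt 2 : ℂ) ≠ 0 := by
  intro h
  have := sqrt2_sq
  rw [h] at this
  norm_num at this

noncomputable def zt : ℂ := (1 + Complex.I) / (Real.sqrt 2 : ℂ)

lemma zt_sq : zt * zt = Complex.I := by
  have h := Complex.I_mul_I
  have h2 := sqrt2_sq
  have h3 := sqrt2_ne
  rw [zt, div_mul_div_comm, h2, div_eq_iff two_ne_zero]
  grind

lemma phi1_eq : phi1 = !![zt, 0; 0, -(Complex.I * zt)] := by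
  have h := Complex.I_mul_I
  have h3 := sqrt2_ne
  have : (1 - Complex.I) / (Real.sqrt 2 : ℂ) = -(Complex.I * zt) := by
    rw [zt]; field_simp; grind
  rw [phi1, this, zt]

lemma phi_mul_I : phi1 * Iq = Iq * phi1 := by
  rw [phi1_eq, Iq]; simp [mul_comm]

lemma phi_mul_J : phi1 * Jq = Kq * phi1 := by
  have h := Complex.I_mul_I
  rw [phi1_eq, Jq, Kq_eq]
  ext i j
  fin_cases i <;> fin_cases j <;> simp <;> grind

lemma phi_mul_K : phi1 * Kq = -Jq * phi1 := by
  have h := Complex.I_mul_I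
  rw [phi1_eq, Jq, Kq_eq]
  ext i j
  fin_cases i <;> fin_cases j <;> simp <;> grind

lemma phi_det : phi1.det = 1 := by
  have h := Complex.I_mul_I
  have := zt_sq
  rw [phi1_eq, Matrix.det_fin_two]
  simp; grind

lemma phi_mul_inv : phi1 * phi1⁻¹ = 1 := Matrix.mul_nonsing_inv _ (by rw [phi_det]; exact isUnit_one)

lemma om_phi : om * phi1 = phi1 * (om * om) * (-Jq) := by
  have h := Complex.I_mul_I
  rw [phi1_eq, Jq]
  ext i j
  fin_cases i <;> fin_cases j <;> simp [om, Matrix.mul_apply, Fin.sum_univ_two] <;> grind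

lemma om_phi_om : om * phi1 * om = phi1 * Iq := by
  have h := Complex.I_mul_I
  rw [phi1_eq, Iq]
  ext i j
  fin_cases i <;> fin_cases j <;> simp [om, Matrix.mul_apply, Fin.sum_univ_two] <;> grind

lemma neg_mem_one {c : ℂ} (h : c ∈ ({1, -1} : Set ℂ)) : -c ∈ ({1, -1} : Set ℂ) := by
  rcases h with rfl | rfl <;> simp

lemma conj_mem : ∀ M ∈ binTet, phi1 * M * phi1⁻¹ ∈ binTet := by
  have key : ∀ A B : Matrix (Fin 2) (Fin 2) ℂ, phi1 * A = B * phi1 → phi1 * A * phi1⁻¹ = B := by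
    intro A B h
    rw [h, Matrix.mul_assoc, phi_mul_inv, Matrix.mul_one]
  have k1 := key 1 1 (by simp)
  have k2 := key _ _ phi_mul_I
  have k3 := key _ _ phi_mul_J
  have k4 := key _ _ phi_mul_K
  rintro M (hM | ⟨a, ha, b, hb, c, hc, e, he, rfl⟩)
  · left
    simp only [Set.mem_insert_iff, Set.mem_singleton_iff] at hM ⊢
    rcases hM with rfl | rfl | rfl | rfl | rfl | rfl | rfl | rfl <;>
      simp only [Matrix.mul_neg, Matrix.neg_mul, k1, k2, k3, k4, neg_neg, true_or, or_true]
  · right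
    refine ⟨a, ha, b, hb, -e, neg_mem_one he, c, hc, ?_⟩
    simp only [Matrix.mul_smul, Matrix.smul_mul, Matrix.mul_add, Matrix.add_mul, k1, k2, k3, k4]
    congr 1
    simp only [smul_neg, neg_smul]
    abel

lemma mem_cast {S : Submonoid (Matrix (Fin 2) (Fin 2) ℂ)} {A B : Matrix (Fin 2) (Fin 2) ℂ}
    (hA : A ∈ S) (h : A = B) : B ∈ S := h ▸ hA

/-- generation: every element of 2T is a word in `I`, `J`, `om`. -/
lemma gen (S : Submonoid (Matrix (Fin 2) (Fin 2) ℂ)) (hI : Iq ∈ S) (hJ : Jq ∈ S) (ho : om ∈ S) :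
    ∀ M ∈ binTet, M ∈ S := by
  have h1 : (1 : Matrix (Fin 2) (Fin 2) ℂ) ∈ S := S.one_mem
  have hm : (-1 : Matrix (Fin 2) (Fin 2) ℂ) ∈ S := I_mul_I' ▸ S.mul_mem hI hI
  have hneg : ∀ A ∈ S, -A ∈ S := fun A hA => by
    have := S.mul_mem hm hA
    simpa using this
  have hK : Kq ∈ S := S.mul_mem hI hJ
  have w1 : ∀ A ∈ S, om * A ∈ S := fun A hA => S.mul_mem ho hA
  have w2 : ∀ A ∈ S, (om * om) * A ∈ S := fun A hA => S.mul_mem (S.mul_mem ho ho) hA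
  rintro M (hM | ⟨a, ha, b, hb, c, hc, e, he, rfl⟩)
  · simp only [Set.mem_insert_iff, Set.mem_singleton_iff] at hM
    rcases hM with rfl | rfl | rfl | rfl | rfl | rfl | rfl | rfl
    exacts [h1, hm, hI, hneg _ hI, hJ, hneg _ hJ, hK, hneg _ hK]
  · have hs := Complex.I_mul_I
    have e1 : (2 : ℂ)⁻¹ • (a • (1 : Matrix (Fin 2) (Fin 2) ℂ) + b • Iq + c • Jq + e • Kq)
        = (2 : ℂ)⁻¹ • !![a + b * Complex.I, -c - e * Complex.I;
            c - e * Complex.I, a - b * Complex.I] := by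
      rw [Kq_eq, Iq, Jq, Matrix.one_fin_two]
      ext i j
      fin_cases i <;> fin_cases j <;> simp <;> ring
    rw [e1]
    have e2 : om * om = (2 : ℂ)⁻¹ • !![-1 + Complex.I, -1 - Complex.I;
            1 - Complex.I, -1 - Complex.I] := by
      ext i j
      fin_cases i <;> fin_cases j <;> simp [om, Matrix.mul_apply, Fin.sum_univ_two] <;> grind
    rw [e2] at w2
    have pI := w1 _ hI
    have pJ := w1 _ hJ
    have pK := w1 _ hK
    have p1 := w1 _ h1
    have qI := w2 _ hI
    have qJ := w2 _ hJ
    have qK := w2 _ hK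
    have q1 := w2 _ h1
    have pI' := hneg _ pI
    have pJ' := hneg _ pJ
    have pK' := hneg _ pK
    have p1' := hneg _ p1
    have qI' := hneg _ qI
    have qJ' := hneg _ qJ
    have qK' := hneg _ qK
    have q1' := hneg _ q1
    rcases ha with rfl | rfl <;> rcases hb with rfl | rfl <;> rcases hc with rfl | rfl <;>
      rcases he with rfl | rfl
    on_goal 1 => refine mem_cast p1 ?_
    on_goal 2 => refine mem_cast qJ' ?_
    on_goal 3 => refine mem_cast qI' ?_
    on_goal 4 => refine mem_cast pJ' ?_
    on_goal 5 => refine mem_cast qK' ?_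
    on_goal 6 => refine mem_cast pK' ?_
    on_goal 7 => refine mem_cast pI' ?_
    on_goal 8 => refine mem_cast q1' ?_
    on_goal 9 => refine mem_cast q1 ?_
    on_goal 10 => refine mem_cast pI ?_
    on_goal 11 => refine mem_cast pK ?_
    on_goal 12 => refine mem_cast qK ?_
    on_goal 13 => refine mem_cast pJ ?_
    on_goal 14 => refine mem_cast qI ?_
    on_goal 15 => refine mem_cast qJ ?_
    on_goal 16 => refine mem_cast p1' ?_
    all_goals
      ext i j
      fin_cases i <;> fin_cases j <;>
        simp [om, Iq, Jq, Kq_eq, Matrix.mul_apply, Fin.sum_univ_two] <;> grind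


/-! ### The representation -/

lemma mact_X (A : Matrix (Fin 2) (Fin 2) ℂ) (i : Fin 2) :
    mact A (MvPolynomial.X i) = ∑ j, A⁻¹ i j • MvPolynomial.X j := by
  simp [mact]

lemma mact_mul (A B : Matrix (Fin 2) (Fin 2) ℂ) : mact (A * B) = (mact A).comp (mact B) := by
  apply MvPolynomial.algHom_ext
  intro i
  rw [AlgHom.comp_apply, mact_X, mact_X, Matrix.mul_inv_rev]
  simp only [map_add, map_smul, mact_X, Matrix.mul_apply, Fin.sum_univ_two, smul_add, add_smul,
    mul_smul]
  abel

lemma mact_one : mact 1 = AlgHom.id ℂ _ := by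
  apply MvPolynomial.algHom_ext
  intro i
  rw [mact_X, inv_one]
  simp [Matrix.one_apply]

abbrev UU (d : ℕ) := MvPolynomial.homogeneousSubmodule (Fin 2) ℂ d

lemma mact_mem (A : Matrix (Fin 2) (Fin 2) ℂ) (d : ℕ) (f : MvPolynomial (Fin 2) ℂ)
    (hf : f ∈ UU d) : (mact A).toLinearMap f ∈ UU d := by
  rw [MvPolynomial.mem_homogeneousSubmodule] at hf ⊢
  have := hf.aeval (S := ℂ) (n := 1) (fun i => ∑ j, A⁻¹ i j • (MvPolynomial.X j : MvPolynomial (Fin 2) ℂ)) (by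
    intro i
    apply MvPolynomial.IsHomogeneous.sum
    intro j _
    rw [MvPolynomial.smul_eq_C_mul]
    exact (MvPolynomial.isHomogeneous_X ℂ j).C_mul _)
  rw [one_mul] at this
  exact this

noncomputable def rho (d : ℕ) : Matrix (Fin 2) (Fin 2) ℂ →* Module.End ℂ (UU d) where
  toFun A := LinearMap.restrict (mact A).toLinearMap (mact_mem A d)
  map_one' := by
    ext1 x
    apply Subtype.ext
    simp [LinearMap.restrict_apply, mact_one]
  map_mul' A B := by
    ext1 x
    apply Subtype.ext
    simp [LinearMap.restrict_apply, mact_mul]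

lemma rho_coe (d : ℕ) (A : Matrix (Fin 2) (Fin 2) ℂ) (x : UU d) :
    ((rho d A x : UU d) : MvPolynomial (Fin 2) ℂ) = mact A x := rfl

noncomputable def ex (d : ℕ) (a : ℕ) : Fin 2 →₀ ℕ :=
  Finsupp.single 0 a + Finsupp.single 1 (d - a)

lemma ex_inj {d a b : ℕ} (h : ex d a = ex d b) : a = b := by
  have := DFunLike.congr_fun h 0
  simpa [ex] using this

lemma ex_deg {d a : ℕ} (h : a ≤ d) : (ex d a).degree = d := by
  rw [ex, map_add, Finsupp.degree_single, Finsupp.degree_single]; omega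

lemma ex_surj {d : ℕ} (m : Fin 2 →₀ ℕ) (h : m.degree = d) : ∃ a : Fin (d+1), m = ex d a := by
  rw [Finsupp.degree_eq_sum, Fin.sum_univ_two] at h
  refine ⟨⟨m 0, by omega⟩, ?_⟩
  ext i
  fin_cases i
  · simp [ex]
  · simp [ex]; omega

noncomputable def eqv (d : ℕ) : UU d ≃ₗ[ℂ] (Fin (d+1) → ℂ) where
  toFun f a := MvPolynomial.coeff (ex d a) f.1
  map_add' f g := by ext a; simp
  map_smul' c f := by ext a; simp
  invFun g := ⟨∑ a : Fin (d+1), MvPolynomial.monomial (ex d a) (g a), by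
    apply Submodule.sum_mem
    intro a _
    rw [MvPolynomial.mem_homogeneousSubmodule]
    exact MvPolynomial.isHomogeneous_monomial _ (ex_deg (by omega))⟩
  left_inv f := by
    apply Subtype.ext
    ext m
    simp only [MvPolynomial.coeff_sum, MvPolynomial.coeff_monomial]
    by_cases hm : m.degree = d
    · obtain ⟨b, rfl⟩ := ex_surj m hm
      rw [Finset.sum_eq_single b]
      · simp
      · intro c _ hc
        rw [if_neg]
        intro h
        exact hc (Fin.ext (ex_inj h))
      · simp
    · rw [Finset.sum_eq_zero]
      · by_contra h
        exact hm (by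
          have := f.2
          rw [MvPolynomial.mem_homogeneousSubmodule] at this
          have := this (Ne.symm h)
          rw [← this, Finsupp.degree_eq_weight_one]; rfl)
      · intro c _
        rw [if_neg]
        rintro rfl
        exact hm (ex_deg (by omega))
  right_inv g := by
    ext b
    simp only [MvPolynomial.coeff_sum, MvPolynomial.coeff_monomial]
    rw [Finset.sum_eq_single b]
    · simp
    · intro c _ hc
      rw [if_neg]
      intro h
      exact hc (Fin.ext (ex_inj h))
    · simp

instance finU (d : ℕ) : Module.Finite ℂ (UU d) := Module.Finite.equiv (eqv d).symm

lemma trace_rho (d : ℕ) (A : Matrix (Fin 2) (Fin 2) ℂ) :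
    LinearMap.trace ℂ (UU d) (rho d A) =
      ∑ a ∈ Finset.range (d+1), MvPolynomial.coeff (ex d a)
        (mact A (MvPolynomial.X 0 ^ a * MvPolynomial.X 1 ^ (d - a))) := by
  rw [LinearMap.trace_eq_matrix_trace ℂ (Module.Basis.ofEquivFun (eqv d)), Matrix.trace,
    Finset.sum_range]
  refine Finset.sum_congr rfl fun a _ => ?_
  rw [Matrix.diag_apply, LinearMap.toMatrix_apply, Module.Basis.ofEquivFun_repr_apply,
    Module.Basis.coe_ofEquivFun]
  have : ((eqv d).symm (Pi.single a 1) : UU d).1 = 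
     MvPolynomial.X 0 ^ (a:ℕ) * MvPolynomial.X 1 ^ (d - a) := by
    change ∑ b : Fin (d+1), MvPolynomial.monomial (ex d b) ((Pi.single a 1 : Fin (d+1) → ℂ) b) = _
    rw [Finset.sum_eq_single a]
    · rw [Pi.single_eq_same, ex, ← one_mul (1:ℂ), ← MvPolynomial.monomial_mul,
        MvPolynomial.X_pow_eq_monomial, MvPolynomial.X_pow_eq_monomial]
    · intro b _ hb
      rw [Pi.single_eq_of_ne hb]; simp
    · simp
  change MvPolynomial.coeff (ex d a) (mact A ((eqv d).symm (Pi.single a 1) : UU d).1) = _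
  rw [this]

lemma coeff_mon (m : Fin 2 →₀ ℕ) (a b : ℕ) (c : ℂ) : MvPolynomial.coeff m
    (c • (MvPolynomial.X 0 ^ a * MvPolynomial.X 1 ^ b : MvPolynomial (Fin 2) ℂ)) =
    if a = m 0 ∧ b = m 1 then c else 0 := by
  rw [MvPolynomial.X_pow_eq_monomial, MvPolynomial.X_pow_eq_monomial, MvPolynomial.monomial_mul,
    MvPolynomial.coeff_smul, MvPolynomial.coeff_monomial]
  have : (Finsupp.single (0 : Fin 2) a + Finsupp.single 1 b = m) ↔ (a = m 0 ∧ b = m 1) := by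
    constructor
    · rintro rfl; simp
    · rintro ⟨rfl, rfl⟩
      ext i; fin_cases i <;> simp
  simp [this]

lemma trace_diag (d : ℕ) (A : Matrix (Fin 2) (Fin 2) ℂ) (p q : ℂ) (hA : A * !![p, 0; 0, q] = 1) :
    LinearMap.trace ℂ (UU d) (rho d A) = ∑ a ∈ Finset.range (d+1), p ^ a * q ^ (d - a) := by
  rw [trace_rho]
  refine Finset.sum_congr rfl fun a ha => ?_
  rw [map_mul, map_pow, map_pow, mact_X, mact_X, Matrix.inv_eq_right_inv hA]
  simp only [Fin.sum_univ_two, Matrix.of_apply, Matrix.cons_val_zero, Matrix.cons_val_one,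
    zero_smul, add_zero, zero_add, smul_pow, smul_mul_smul_comm, Matrix.cons_val', Matrix.cons_val_fin_one]
  rw [coeff_mon, if_pos]
  simp [ex]

lemma trace_anti (d : ℕ) (A : Matrix (Fin 2) (Fin 2) ℂ) (p q : ℂ) (hA : A * !![0, p; q, 0] = 1) :
    LinearMap.trace ℂ (UU d) (rho d A) = if d % 2 = 0 then (p * q) ^ (d / 2) else 0 := by
  rw [trace_rho]
  have : ∀ a ∈ Finset.range (d+1), MvPolynomial.coeff (ex d a)
        (mact A (MvPolynomial.X 0 ^ a * MvPolynomial.X 1 ^ (d - a))) =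
        if d = 2 * a then (p * q) ^ (d/2) else 0 := by
    intro a ha
    rw [Finset.mem_range] at ha
    rw [map_mul, map_pow, map_pow, mact_X, mact_X, Matrix.inv_eq_right_inv hA]
    simp only [Fin.sum_univ_two, Matrix.of_apply, Matrix.cons_val_zero, Matrix.cons_val_one,
      zero_smul, add_zero, zero_add, smul_pow, smul_mul_smul_comm, Matrix.cons_val', Matrix.cons_val_fin_one]
    rw [mul_comm (MvPolynomial.X 1 ^ a), coeff_mon]
    have e : (d - a = (ex d a) 0 ∧ a = (ex d a) 1) ↔ d = 2 * a := by
      simp [ex]; omega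
    simp only [e]
    split_ifs with h
    · have h1 : d - a = a := by omega
      have h2 : d / 2 = a := by omega
      rw [h1, h2, mul_pow]
    · rfl
  rw [Finset.sum_congr rfl this]
  split_ifs with h
  · rw [Finset.sum_eq_single (d/2)]
    · rw [if_pos (by omega)]
    · intro b _ hb
      rw [if_neg (by omega)]
    · intro h; exact absurd (Finset.mem_range.2 (by omega)) h
  · apply Finset.sum_eq_zero
    intro a _
    rw [if_neg (by omega)]


/-! ### Averaging -/

lemma mem_inv (d : ℕ) (f : MvPolynomial (Fin 2) ℂ) :
    f ∈ invariants binTet d ↔ f ∈ UU d ∧ ∀ A ∈ binTet, mact A f = f := by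
  simp [invariants, Submodule.mem_iInf, LinearMap.mem_eqLocus]

lemma mem_inv_gen (d : ℕ) (f : MvPolynomial (Fin 2) ℂ) (hf : f ∈ UU d) (hI : mact Iq f = f)
    (hJ : mact Jq f = f) (ho : mact om f = f) : f ∈ invariants binTet d := by
  rw [mem_inv]
  refine ⟨hf, ?_⟩
  let S : Submonoid (Matrix (Fin 2) (Fin 2) ℂ) :=
    { carrier := {A | mact A f = f}
      one_mem' := by simp [mact_one]
      mul_mem' := by
        intro A B hA hB
        simp only [Set.mem_ofPred_eq] at hA hB ⊢
        rw [mact_mul, AlgHom.comp_apply, hB, hA] }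
  exact gen S hI hJ ho

lemma I_mem : Iq ∈ binTet := by left; simp
lemma J_mem : Jq ∈ binTet := by left; simp
lemma K_mem : Kq ∈ binTet := by left; simp
lemma nI_mem : -Iq ∈ binTet := by left; simp
lemma nJ_mem : -Jq ∈ binTet := by left; simp
lemma nK_mem : -Kq ∈ binTet := by left; simp
lemma n1_mem : -1 ∈ binTet := by left; simp
lemma om_mem : om ∈ binTet := by
  right
  exact ⟨1, by simp, 1, by simp, 1, by simp, 1, by simp, om_eq⟩

lemma phi_stable (d : ℕ) (x : MvPolynomial (Fin 2) ℂ) (hx : x ∈ invariants binTet d) :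
    (mact phi1).toLinearMap x ∈ invariants binTet d := by
  have hx' := (mem_inv d x).1 hx
  have key : ∀ A B, A * phi1 = phi1 * B → B ∈ binTet → 
      mact A ((mact phi1).toLinearMap x) = (mact phi1).toLinearMap x := by
    intro A B h hB
    change mact A (mact phi1 x) = mact phi1 x
    rw [← AlgHom.comp_apply, ← mact_mul, h, mact_mul, AlgHom.comp_apply, hx'.2 B hB]
  refine mem_inv_gen d _ (mact_mem _ _ _ hx'.1) (key _ _ phi_mul_I.symm I_mem)
    (key _ (-Kq) (by rw [Matrix.mul_neg, phi_mul_K, Matrix.neg_mul, neg_neg]) nK_mem) ?_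
  change mact om (mact phi1 x) = mact phi1 x
  rw [← AlgHom.comp_apply, ← mact_mul, om_phi, mact_mul, mact_mul, mact_mul]
  simp only [AlgHom.comp_apply]
  rw [hx'.2 _ nJ_mem, hx'.2 _ om_mem, hx'.2 _ om_mem]

noncomputable def eQ (d : ℕ) : Module.End ℂ (UU d) :=
  (8 : ℂ)⁻¹ • (rho d 1 + rho d (-1) + rho d Iq + rho d (-Iq) + rho d Jq + rho d (-Jq)
    + rho d Kq + rho d (-Kq))

lemma I_mul_J' : Iq * Jq = Kq := rfl

lemma I_mul_K' : Iq * Kq = -Jq := by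
  rw [Kq, ← Matrix.mul_assoc, I_mul_I', Matrix.neg_mul, Matrix.one_mul]

lemma J_mul_K' : Jq * Kq = Iq := by
  rw [Kq, ← Matrix.mul_assoc, J_mul_I', Kq, Matrix.neg_mul, Matrix.mul_assoc, J_mul_J']
  simp

lemma perm8a {M : Type*} [AddCommMonoid M] (a b c e f g h k : M) :
    c + e + b + a + h + k + g + f = a + b + c + e + f + g + h + k := by abel

lemma perm8b {M : Type*} [AddCommMonoid M] (a b c e f g h k : M) :
    f + g + k + h + b + a + c + e = a + b + c + e + f + g + h + k := by abel

lemma perm8c {M : Type*} [AddCommMonoid M] (a b c e f g h k : M) :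
    a + b + f + g + h + k + c + e = a + b + c + e + f + g + h + k := by abel

lemma perm3 {M : Type*} [AddCommMonoid M] (a b c : M) : b + c + a = a + b + c := by abel

lemma I_eQ (d : ℕ) : rho d Iq * eQ d = eQ d := by
  simp only [eQ, mul_smul_comm, mul_add, ← map_mul, Matrix.mul_neg, I_mul_I', I_mul_J', I_mul_K',
    Matrix.mul_one, neg_neg]
  exact congrArg _ (perm8a _ _ _ _ _ _ _ _)

lemma J_eQ (d : ℕ) : rho d Jq * eQ d = eQ d := by
  simp only [eQ, mul_smul_comm, mul_add, ← map_mul, Matrix.mul_neg, J_mul_I', J_mul_J', J_mul_K',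
    Matrix.mul_one, neg_neg]
  exact congrArg _ (perm8b _ _ _ _ _ _ _ _)

lemma n1_eQ (d : ℕ) : rho d (-1) * eQ d = eQ d := by
  rw [← I_mul_I', map_mul, mul_assoc, I_eQ, I_eQ]

lemma nJ_eQ (d : ℕ) : rho d (-Jq) * eQ d = eQ d := by
  have : -Jq = Jq * -1 := by simp
  rw [this, map_mul, mul_assoc, n1_eQ, J_eQ]

lemma om_eQ (d : ℕ) : rho d om * eQ d = eQ d * rho d om := by
  simp only [eQ, mul_smul_comm, smul_mul_assoc, mul_add, add_mul, ← map_mul, Matrix.mul_neg,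
    Matrix.neg_mul, om_mul_I, om_mul_J, om_mul_K, Matrix.mul_one, Matrix.one_mul]
  exact congrArg _ (perm8c _ _ _ _ _ _ _ _)

noncomputable def PP (d : ℕ) : Module.End ℂ (UU d) :=
  (3 : ℂ)⁻¹ • (eQ d + rho d om * eQ d + rho d om * (rho d om * eQ d))

lemma PP_eq (d : ℕ) : PP d = eQ d * ((3 : ℂ)⁻¹ • (1 + rho d om + rho d om * rho d om)) := by
  simp only [PP, mul_smul_comm, mul_add, mul_one]
  rw [om_eQ, ← mul_assoc (rho d om), om_eQ, mul_assoc (eQ d)]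

lemma I_PP (d : ℕ) : rho d Iq * PP d = PP d := by
  rw [PP_eq, ← mul_assoc, I_eQ]

lemma J_PP (d : ℕ) : rho d Jq * PP d = PP d := by
  rw [PP_eq, ← mul_assoc, J_eQ]

lemma om_PP (d : ℕ) : rho d om * PP d = PP d := by
  have : rho d om * (rho d om * (rho d om * eQ d)) = eQ d := by
    rw [← mul_assoc, ← mul_assoc, ← map_mul, ← map_mul, om_cube, n1_eQ]
  simp only [PP, mul_smul_comm, mul_add, this]
  exact congrArg _ (perm3 _ _ _)

lemma PP_mem (d : ℕ) (x : UU d) : (PP d x : MvPolynomial (Fin 2) ℂ) ∈ invariants binTet d := by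
  refine mem_inv_gen d _ (PP d x).2 ?_ ?_ ?_
  · exact congrArg Subtype.val (LinearMap.congr_fun (I_PP d) x)
  · exact congrArg Subtype.val (LinearMap.congr_fun (J_PP d) x)
  · exact congrArg Subtype.val (LinearMap.congr_fun (om_PP d) x)

lemma PP_fix (d : ℕ) (x : UU d) (hx : (x : MvPolynomial (Fin 2) ℂ) ∈ invariants binTet d) :
    PP d x = x := by
  have hx' := (mem_inv d x).1 hx
  have key : ∀ A ∈ binTet, rho d A x = x := fun A hA => Subtype.ext (hx'.2 A hA)
  have he : eQ d x = x := by
    simp only [eQ, LinearMap.smul_apply, LinearMap.add_apply, key _ I_mem, key _ J_mem,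
      key _ K_mem, key _ nI_mem, key _ nJ_mem, key _ nK_mem, key _ n1_mem, map_one,
      Module.End.one_apply]
    module
  simp only [PP, LinearMap.smul_apply, LinearMap.add_apply, Module.End.mul_apply, he,
    key _ om_mem]
  module

lemma trace_step (d : ℕ) : LinearMap.trace ℂ (UU d) (rho d phi1 * PP d) =
    LinearMap.trace ℂ (UU d) (rho d phi1 * eQ d) := by
  have h2 : LinearMap.trace ℂ (UU d) (rho d phi1 * (rho d om * (rho d om * eQ d))) =
      LinearMap.trace ℂ (UU d) (rho d phi1 * (rho d om * eQ d)) := by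
    have : rho d phi1 * (rho d om * (rho d om * eQ d)) = rho d om * (rho d phi1 * eQ d) := by
      rw [← mul_assoc (rho d om) (rho d phi1), ← map_mul, om_phi, map_mul, mul_assoc, nJ_eQ]
      simp only [map_mul, mul_assoc]
    rw [this, LinearMap.trace_mul_comm, mul_assoc, ← om_eQ]
  have h0 : LinearMap.trace ℂ (UU d) (rho d phi1 * eQ d) = 
      LinearMap.trace ℂ (UU d) (rho d phi1 * (rho d om * (rho d om * eQ d))) := by
    have : rho d phi1 * eQ d = rho d om * (rho d phi1 * (rho d om * eQ d)) := by
      rw [← mul_assoc (rho d phi1), ← mul_assoc, ← map_mul, ← map_mul, ← mul_assoc, om_phi_om,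
        map_mul, mul_assoc, I_eQ]
    rw [this, LinearMap.trace_mul_comm, mul_assoc, mul_assoc, ← om_eQ]
  simp only [PP, mul_smul_comm, mul_add, map_smul, map_add]
  rw [← h2, ← h0, smul_eq_mul]
  ring

lemma trace_W (d : ℕ) (h : ∀ x ∈ invariants binTet d,
      (mact phi1).toLinearMap x ∈ invariants binTet d) :
    LinearMap.trace ℂ (invariants binTet d) (LinearMap.restrict (mact phi1).toLinearMap h) =
    LinearMap.trace ℂ (UU d) (rho d phi1 * PP d) := by
  have hle : invariants binTet d ≤ UU d := inf_le_left
  let io : invariants binTet d →ₗ[ℂ] UU d := Submodule.inclusion hle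
  haveI : Module.Finite ℂ (invariants binTet d) :=
    Module.Finite.of_injective io (Submodule.inclusion_injective hle)
  let p : UU d →ₗ[ℂ] invariants binTet d :=
    LinearMap.codRestrict _ ((UU d).subtype ∘ₗ PP d) (PP_mem d)
  have e1 : LinearMap.restrict (mact phi1).toLinearMap h = p ∘ₗ (rho d phi1 ∘ₗ io) := by
    ext1 x
    apply Subtype.ext
    change _ = ((PP d (rho d phi1 (io x)) : UU d) : MvPolynomial (Fin 2) ℂ)
    rw [PP_fix d _ (h x.1 x.2)]
    rfl
  rw [e1, LinearMap.trace_comp_comm']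
  rfl

lemma geo (d : ℕ) (a b : ℂ) (hab : a * b = 1) (ha : a ^ 4 = -1) :
    (∑ i ∈ Finset.range (d+1), a ^ i * b ^ (d - i)) +
      (∑ i ∈ Finset.range (d+1), (-a) ^ i * (-b) ^ (d - i)) =
    if d % 2 = 1 then 0 else if d % 8 < 4 then 2 else -2 := by
  have hneg : (∑ i ∈ Finset.range (d+1), (-a) ^ i * (-b) ^ (d - i)) =
      (-1) ^ d * ∑ i ∈ Finset.range (d+1), a ^ i * b ^ (d - i) := by
    rw [Finset.mul_sum]
    refine Finset.sum_congr rfl fun i hi => ?_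
    rw [Finset.mem_range] at hi
    have : (-1 : ℂ) ^ d = (-1) ^ i * (-1) ^ (d - i) := by rw [← pow_add]; congr 1; omega
    rw [neg_pow a, neg_pow b, this]; ring
  rw [hneg]
  have hb : b = -a ^ 3 := by grind
  have hne : a - b ≠ 0 := by grind
  have hg := (Commute.all a b).geom_sum₂_mul (d + 1)
  simp only [Nat.add_sub_cancel] at hg
  generalize (∑ i ∈ Finset.range (d+1), a ^ i * b ^ (d - i)) = T at hg ⊢
  have hT : ∀ c, c * (a - b) = a ^ (d + 1) - b ^ (d + 1) → T = c := fun c hc =>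
    mul_right_cancel₀ hne (hg.trans hc.symm)
  obtain ⟨k, r, hr, rfl⟩ : ∃ k r, r < 8 ∧ d = 8 * k + r :=
    ⟨d / 8, d % 8, Nat.mod_lt _ (by norm_num), (Nat.div_add_mod d 8).symm⟩
  have a8 : a ^ 8 = 1 := by grind
  have b8 : b ^ 8 = 1 := by grind
  have m8 : (-1 : ℂ) ^ 8 = 1 := by norm_num
  have e1 : (8 * k + r) % 2 = r % 2 := by omega
  have e2 : (8 * k + r) % 8 = r := by omega
  simp only [add_assoc, pow_add _ (8 * k), pow_mul, a8, b8, m8, one_pow, one_mul] at hT ⊢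
  rw [e1, e2]
  by_cases hodd : r % 2 = 1
  · rw [if_pos hodd, (Nat.odd_iff.2 hodd).neg_one_pow]; ring
  · rw [if_neg hodd, (Nat.even_iff.2 (by omega)).neg_one_pow]
    interval_cases r
    · rw [hT 1 (by ring)]; norm_num
    · omega
    · rw [hT 1 (by grind)]; norm_num
    · omega
    · rw [hT (-1) (by grind)]; norm_num
    · omega
    · rw [hT (-1) (by grind)]; norm_num
    · omega

lemma trace_eQ (d : ℕ) : LinearMap.trace ℂ (UU d) (rho d phi1 * eQ d) =
    if d % 8 = 0 then 1 else if d % 8 = 6 then -1 else 0 := by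
  have hI := Complex.I_mul_I
  have hz := zt_sq
  have z4 : zt ^ 4 = -1 := by grind
  set z := zt with hzdef
  set i := Complex.I with hidef
  have t1 := trace_diag d (phi1 * 1) (-(i * z)) z (by
    rw [phi1_eq, Matrix.one_fin_two]; simp [← hzdef, ← hidef]; grind)
  have t2 := trace_diag d (phi1 * -1) (i * z) (-z) (by
    rw [phi1_eq, Matrix.one_fin_two]; simp [← hzdef, ← hidef]; grind)
  have t3 := trace_diag d (phi1 * Iq) (-z) (i * z) (by
    rw [phi1_eq, Iq, Matrix.one_fin_two]; simp [← hzdef, ← hidef]; grind)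
  have t4 := trace_diag d (phi1 * -Iq) z (-(i * z)) (by
    rw [phi1_eq, Iq, Matrix.one_fin_two]; simp [← hzdef, ← hidef]; grind)
  have t5 := trace_anti d (phi1 * Jq) z (i * z) (by
    rw [phi1_eq, Jq, Matrix.one_fin_two]; simp [← hzdef, ← hidef]; grind)
  have t6 := trace_anti d (phi1 * -Jq) (-z) (-(i * z)) (by
    rw [phi1_eq, Jq, Matrix.one_fin_two]; simp [← hzdef, ← hidef]; grind)
  have t7 := trace_anti d (phi1 * Kq) (i * z) z (by
    rw [phi1_eq, Kq_eq, Matrix.one_fin_two]; simp [← hzdef, ← hidef]; grind)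
  have t8 := trace_anti d (phi1 * -Kq) (-(i * z)) (-z) (by
    rw [phi1_eq, Kq_eq, Matrix.one_fin_two]; simp [← hzdef, ← hidef]; grind)
  have g1 := geo d (-(i * z)) z (by grind) (by grind)
  have g2 := geo d z (-(i * z)) (by grind) (by grind)
  rw [neg_neg] at g1 g2
  rw [← t1, ← t2] at g1
  rw [← t3, ← t4] at g2
  rw [show z * (i * z) = -1 by grind] at t5
  rw [show -z * -(i * z) = -1 by grind] at t6
  rw [show i * z * z = -1 by grind] at t7
  rw [show -(i * z) * -z = -1 by grind] at t8
  simp only [eQ, mul_smul_comm, mul_add, map_smul, map_add, ← map_mul]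
  rw [t5, t6, t7, t8, smul_eq_mul]
  have fin : ∀ x1 x2 x3 x4 y c : ℂ, x1 + x2 = c → x4 + x3 = c →
      (8:ℂ)⁻¹ * (x1 + x2 + x3 + x4 + y + y + y + y) = (c + 2 * y) / 4 := by
    intros; grind
  rw [fin _ _ _ _ _ _ g1 g2]
  obtain ⟨k, r, hr, rfl⟩ : ∃ k r, r < 8 ∧ d = 8 * k + r :=
    ⟨d / 8, d % 8, Nat.mod_lt _ (by norm_num), (Nat.div_add_mod d 8).symm⟩
  have e1 : (8 * k + r) % 2 = r % 2 := by omega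
  have e2 : (8 * k + r) % 8 = r := by omega
  have e3 : (8 * k + r) / 2 = 2 * (2 * k) + r / 2 := by omega
  rw [e1, e2, e3, pow_add, pow_mul]
  interval_cases r <;> norm_num

theorem statement8 :
    (∀ M ∈ binTet, phi1 * M * phi1⁻¹ ∈ binTet) ∧
    ∀ d : ℕ,
      ∃ h : ∀ x ∈ invariants binTet d, (mact phi1).toLinearMap x ∈ invariants binTet d,
        LinearMap.trace ℂ (invariants binTet d)
            (LinearMap.restrict (mact phi1).toLinearMap h) =
          if d % 8 = 0 then 1 else if d % 8 = 6 then -1 else 0 := by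
  refine ⟨conj_mem, fun d => ⟨phi_stable d, ?_⟩⟩
  rw [trace_W, trace_step, trace_eQ]
end

section
/- For every integer d ≥ 0, the dimension of the space V_d^{G_p} of G_p-invariant homogeneous polynomials of degree d equals: ⌊d/(2p)⌋ + 1 if d ≡ 0 (mod 4); ⌊d/(2p)⌋ if d ≡ 2 (mod 4); and 0 if d is odd. -/
open Matrix

/-- The diagonal matrix `t = [[ζ,0],[0,ζ⁻¹]]`. -/
noncomputable def tmat (ζ : ℂ) : Matrix (Fin 2) (Fin 2) ℂ := !![ζ, 0; 0, ζ⁻¹]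

/-- The matrix `w = [[0,1],[−1,0]]`. -/
def wmat : Matrix (Fin 2) (Fin 2) ℂ := !![0, 1; -1, 0]

noncomputable def mon2 (a b : ℕ) : Fin 2 →₀ ℕ := Finsupp.single 0 a + Finsupp.single 1 b

lemma mon2_zero (a b : ℕ) : mon2 a b 0 = a := by simp [mon2]
lemma mon2_one (a b : ℕ) : mon2 a b 1 = b := by simp [mon2]

lemma mon2_eta (n : Fin 2 →₀ ℕ) : mon2 (n 0) (n 1) = n := by
  ext i; fin_cases i
  · exact mon2_zero _ _
  · exact mon2_one _ _

lemma mon2_inj {a b c d : ℕ} : mon2 a b = mon2 c d ↔ a = c ∧ b = d := by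
  constructor
  · intro h
    have h0 := DFunLike.congr_fun h 0
    have h1 := DFunLike.congr_fun h 1
    rw [mon2_zero, mon2_zero] at h0
    rw [mon2_one, mon2_one] at h1
    exact ⟨h0, h1⟩
  · rintro ⟨rfl, rfl⟩; rfl

lemma monomial_mon2 (a b : ℕ) (c : ℂ) :
    MvPolynomial.monomial (mon2 a b) c = MvPolynomial.C c * (MvPolynomial.X 0 ^ a * MvPolynomial.X 1 ^ b) := by
  rw [MvPolynomial.X_pow_eq_monomial, MvPolynomial.X_pow_eq_monomial, MvPolynomial.monomial_mul,
    MvPolynomial.C_mul_monomial]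
  simp [mon2]

lemma tinv (ζ : ℂ) (h : ζ ≠ 0) : (tmat ζ)⁻¹ = !![ζ⁻¹, 0; 0, ζ] := by
  apply Matrix.inv_eq_right_inv
  ext i j; fin_cases i <;> fin_cases j <;> simp [tmat, h]

lemma winv : (wmat)⁻¹ = !![0, -1; 1, 0] := by
  apply Matrix.inv_eq_right_inv
  ext i j; fin_cases i <;> fin_cases j <;> simp [wmat]

lemma mact_t_mon (ζ : ℂ) (h : ζ ≠ 0) (a b : ℕ) (c : ℂ) :
    mact (tmat ζ) (MvPolynomial.monomial (mon2 a b) c) =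
      MvPolynomial.monomial (mon2 a b) (ζ⁻¹ ^ a * ζ ^ b * c) := by
  rw [monomial_mon2, monomial_mon2]
  simp only [mact, tinv ζ h, map_mul, map_pow, MvPolynomial.aeval_X, Fin.sum_univ_two]
  simp [MvPolynomial.smul_eq_C_mul]
  ring

lemma mact_w_mon (a b : ℕ) (c : ℂ) :
    mact wmat (MvPolynomial.monomial (mon2 a b) c) =
      MvPolynomial.monomial (mon2 b a) ((-1) ^ a * c) := by
  rw [monomial_mon2, monomial_mon2]
  simp only [mact, winv, map_mul, map_pow, MvPolynomial.aeval_X, Fin.sum_univ_two]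
  simp [MvPolynomial.smul_eq_C_mul]
  rw [neg_pow]
  ring

lemma coeff_t (ζ : ℂ) (h : ζ ≠ 0) (f : MvPolynomial (Fin 2) ℂ) (a b : ℕ) :
    (mact (tmat ζ) f).coeff (mon2 a b) = ζ⁻¹ ^ a * ζ ^ b * f.coeff (mon2 a b) := by
  induction f using MvPolynomial.induction_on' with
  | monomial n c =>
    rw [← mon2_eta n, mact_t_mon ζ h, MvPolynomial.coeff_monomial, MvPolynomial.coeff_monomial]
    simp only [mon2_inj]
    split_ifs with h
    · rw [h.1, h.2]
    · simp
  | add f g hf hg => rw [map_add, MvPolynomial.coeff_add, MvPolynomial.coeff_add, hf, hg, mul_add]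

lemma coeff_w (f : MvPolynomial (Fin 2) ℂ) (a b : ℕ) :
    (mact wmat f).coeff (mon2 b a) = (-1) ^ a * f.coeff (mon2 a b) := by
  induction f using MvPolynomial.induction_on' with
  | monomial n c =>
    rw [← mon2_eta n, mact_w_mon, MvPolynomial.coeff_monomial, MvPolynomial.coeff_monomial]
    simp only [mon2_inj, and_comm (a := n 1 = b)]
    split_ifs with h
    · rw [h.1]
    · simp
  | add f g hf hg => rw [map_add, MvPolynomial.coeff_add, MvPolynomial.coeff_add, hf, hg, mul_add]

lemma mem_inv_s12 (ζ : ℂ) (d : ℕ) (f : MvPolynomial (Fin 2) ℂ) :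
    f ∈ invariants (Submonoid.closure ({tmat ζ, wmat} : Set (Matrix (Fin 2) (Fin 2) ℂ))) d ↔
      f.IsHomogeneous d ∧ mact (tmat ζ) f = f ∧ mact wmat f = f := by
  simp only [invariants, Submodule.mem_inf, MvPolynomial.mem_homogeneousSubmodule,
    Submodule.mem_iInf, LinearMap.mem_eqLocus, AlgHom.toLinearMap_apply, LinearMap.id_apply]
  refine and_congr_right fun _ => ⟨fun h => ⟨?_, ?_⟩, ?_⟩
  · exact h _ (Submonoid.subset_closure (by simp))
  · exact h _ (Submonoid.subset_closure (by simp))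
  · rintro ⟨ht, hw⟩ A hA
    induction hA using Submonoid.closure_induction with
    | mem x hx =>
      rcases hx with rfl | hx
      · exact ht
      · rw [Set.mem_singleton_iff.1 hx]; exact hw
    | one => rw [mact_one]; rfl
    | mul x y _ _ hx hy => rw [mact_mul, AlgHom.comp_apply, hy, hx]

/-- the symmetrised monomial -/
noncomputable def bvec (a b : ℕ) : MvPolynomial (Fin 2) ℂ :=
  MvPolynomial.monomial (mon2 a b) 1 + MvPolynomial.monomial (mon2 b a) ((-1) ^ a)

lemma mon2_hom (a b : ℕ) (c : ℂ) :
    (MvPolynomial.monomial (mon2 a b) c).IsHomogeneous (a + b) := by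
  apply MvPolynomial.isHomogeneous_monomial
  simp [mon2]

lemma bvec_mem (p : ℕ) (ζ : ℂ) (h0 : ζ ≠ 0) (hζ : ζ ^ p = 1) (m a b k : ℕ)
    (hs : a + b = 2 * m) (hab : a = b + 2 * (k * p)) :
    bvec a b ∈ invariants (Submonoid.closure ({tmat ζ, wmat} : Set (Matrix (Fin 2) (Fin 2) ℂ)))
      (2 * m) := by
  rw [mem_inv_s12]
  have hz : ζ ^ a = ζ ^ b := by
    rw [hab, pow_add, show 2 * (k * p) = p * (2 * k) by ring, pow_mul, hζ]; simp
  refine ⟨?_, ?_, ?_⟩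
  · apply MvPolynomial.IsHomogeneous.add
    · rw [← hs]; exact mon2_hom _ _ _
    · rw [← hs, add_comm]; exact mon2_hom _ _ _
  · rw [bvec, map_add, mact_t_mon ζ h0, mact_t_mon ζ h0]
    have hb : ζ ^ b ≠ 0 := pow_ne_zero _ h0
    rw [inv_pow, inv_pow, hz, inv_mul_cancel₀ hb]
    simp
  · rw [bvec, map_add, mact_w_mon, mact_w_mon, add_comm]
    rw [← pow_add, show (-1 : ℂ) ^ (b + a) = 1 by rw [add_comm, hs, pow_mul]; simp, mul_one]

lemma coeff_bvec (a b c d : ℕ) : (bvec a b).coeff (mon2 c d) =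
    (if a = c ∧ b = d then 1 else 0) + (if b = c ∧ a = d then (-1) ^ a else 0) := by
  simp only [bvec, MvPolynomial.coeff_add, MvPolynomial.coeff_monomial, mon2_inj]

lemma even_case (p : ℕ) (hp : p.Prime) (hpodd : Odd p) (ζ : ℂ)
    (hζ : IsPrimitiveRoot ζ p) (m e N : ℕ) (he : (Even m ∧ e = 0) ∨ (Odd m ∧ e = 1))
    (hN : N + e = m / p + 1) :
    Module.finrank ℂ
        (invariants (Submonoid.closure ({tmat ζ, wmat} : Set (Matrix (Fin 2) (Fin 2) ℂ))) (2 * m))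
      = N := by
  have h0 : ζ ≠ 0 := hζ.ne_zero hp.ne_zero
  have hkp : ∀ k : Fin N, (k + e) * p ≤ m := fun k => by
    have : (k : ℕ) + e ≤ m / p := by have := k.2; omega
    exact (Nat.le_div_iff_mul_le hp.pos).1 this
  let Φ : (invariants (Submonoid.closure ({tmat ζ, wmat} : Set (Matrix (Fin 2) (Fin 2) ℂ)))
      (2 * m)) →ₗ[ℂ] (Fin N → ℂ) := LinearMap.pi fun k =>
        (MvPolynomial.lcoeff ℂ (mon2 (m + (k + e) * p) (m - (k + e) * p))).comp
          (Submodule.subtype _)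
  have hΦ : ∀ f k, Φ f k = (f : MvPolynomial (Fin 2) ℂ).coeff
      (mon2 (m + (k + e) * p) (m - (k + e) * p)) := fun f k => rfl
  have hinj : Function.Injective Φ := by
    rw [← LinearMap.ker_eq_bot, LinearMap.ker_eq_bot']
    rintro ⟨f, hf⟩ hz
    obtain ⟨hh, ht, hw⟩ := (mem_inv_s12 _ _ _).1 hf
    have key : ∀ a b, b ≤ a → f.coeff (mon2 a b) = 0 := by
      intro a b hba
      by_contra hne
      have hd : a + b = 2 * m := by
        have := hh hne
        simpa [mon2, Finsupp.weight_apply, Finsupp.sum_add_index'] using this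
      have ht' := coeff_t ζ h0 f a b
      rw [ht] at ht'
      have h1 : ζ⁻¹ ^ a * ζ ^ b = 1 := by
        have : (ζ⁻¹ ^ a * ζ ^ b) * f.coeff (mon2 a b) = 1 * f.coeff (mon2 a b) := by
          rw [← ht', one_mul]
        exact mul_right_cancel₀ hne this
      have h2 : ζ ^ (a - b) = 1 := by
        have hb : ζ ^ b ≠ 0 := pow_ne_zero _ h0
        have ha : ζ ^ a ≠ 0 := pow_ne_zero _ h0
        rw [inv_pow] at h1
        have : ζ ^ b = ζ ^ a := by
          field_simp at h1; exact h1
        have h3 : ζ ^ (a - b) * ζ ^ b = 1 * ζ ^ b := by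
          rw [← pow_add, Nat.sub_add_cancel hba, this, one_mul]
        exact mul_right_cancel₀ hb h3
      have h3 : p ∣ a - b := hζ.dvd_of_pow_eq_one _ h2
      have h4 : a - b = 2 * (m - b) := by omega
      rw [h4] at h3
      have h5 : p ∣ m - b := by
        refine (Nat.Coprime.dvd_mul_left ?_).1 h3
        exact hpodd.coprime_two_right
      obtain ⟨k, hk⟩ := h5
      have hbm : b ≤ m := by omega
      have hkm : k ≤ m / p := by
        rw [Nat.le_div_iff_mul_le hp.pos, mul_comm]; omega
      rcases Nat.lt_or_ge k e with hlt | hge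
      · -- k = 0, m odd
        rcases he with ⟨_, he⟩ | ⟨hm, he⟩
        · omega
        · have hk0 : k = 0 := by omega
          subst hk0
          have hb : b = m := by omega
          have ha : a = m := by omega
          subst hb; subst ha
          have := coeff_w f a a
          rw [hw, hm.neg_one_pow] at this
          apply hne
          linear_combination this / 2
      · have hkN : k - e < N := by omega
        have := congrFun hz ⟨k - e, hkN⟩
        rw [hΦ] at this
        simp only [Nat.sub_add_cancel hge] at this
        rw [mul_comm k p, ← hk] at this
        rw [show m + (m - b) = a by omega, show m - (m - b) = b by omega] at this
        exact hne this
    have key2 : f = 0 := by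
      ext n
      rw [← mon2_eta n, MvPolynomial.coeff_zero]
      rcases le_total (n 1) (n 0) with h | h
      · exact key _ _ h
      · have := coeff_w f (n 1) (n 0)
        rw [hw, key _ _ h, mul_zero] at this
        exact this
    exact Subtype.ext key2
  have hsurj : Function.Surjective Φ := by
    intro g
    have hmem : ∀ k : Fin N, bvec (m + (k + e) * p) (m - (k + e) * p) ∈ _ := fun k =>
      bvec_mem p ζ h0 hζ.pow_eq_one m _ _ (k + e) (by have := hkp k; omega)
        (by have := hkp k; omega)
    let c : Fin N → ℂ := fun k => if (k : ℕ) + e = 0 then 2 else 1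
    have hc : ∀ k, c k ≠ 0 := fun k => by
      simp only [c]; split_ifs <;> norm_num
    refine ⟨∑ k, (g k / c k) • ⟨_, hmem k⟩, ?_⟩
    rw [map_sum]
    funext j
    rw [Finset.sum_apply, Finset.sum_eq_single j]
    · rw [map_smul, Pi.smul_apply, hΦ, smul_eq_mul]
      have : (bvec (m + (j + e) * p) (m - (j + e) * p)).coeff
          (mon2 (m + (j + e) * p) (m - (j + e) * p)) = c j := by
        rw [coeff_bvec, if_pos ⟨rfl, rfl⟩]
        simp only [c]
        by_cases h : (j : ℕ) + e = 0
        · rw [if_pos h]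
          have hm : Even m := by
            rcases he with h | h
            · exact h.1
            · omega
          rw [h]
          simp [hm.neg_one_pow]
          norm_num
        · rw [if_neg h, if_neg, add_zero]
          have : 0 < ((j : ℕ) + e) * p := Nat.mul_pos (Nat.pos_of_ne_zero h) hp.pos
          omega
      simp only
      rw [this, div_mul_cancel₀ _ (hc j)]
    · intro k _ hkj
      rw [map_smul, Pi.smul_apply, hΦ, smul_eq_mul]
      simp only
      have hne : ((k : ℕ) + e) * p ≠ (j + e) * p := by
        intro h
        have := Nat.eq_of_mul_eq_mul_right hp.pos h
        exact hkj (Fin.ext (by omega))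
      rw [coeff_bvec, if_neg (by omega), if_neg (by omega)]
      simp
    · simp
  rw [(LinearEquiv.ofBijective Φ ⟨hinj, hsurj⟩).finrank_eq]
  simp

lemma odd_case (ζ : ℂ) (d : ℕ) (hd : Odd d) :
    invariants (Submonoid.closure ({tmat ζ, wmat} : Set (Matrix (Fin 2) (Fin 2) ℂ))) d = ⊥ := by
  rw [eq_bot_iff]
  intro f hf
  obtain ⟨hh, ht, hw⟩ := (mem_inv_s12 _ _ _).1 hf
  rw [Submodule.mem_bot]
  ext n
  rw [← mon2_eta n, MvPolynomial.coeff_zero]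
  by_contra hne
  have hs : n 0 + n 1 = d := by
    have := hh hne
    simpa [mon2, Finsupp.weight_apply, Finsupp.sum_add_index'] using this
  have h1 := coeff_w f (n 0) (n 1)
  have h2 := coeff_w f (n 1) (n 0)
  rw [hw] at h1 h2
  rw [h1, ← mul_assoc, ← pow_add, add_comm, hs, hd.neg_one_pow] at h2
  apply hne
  linear_combination h2 / 2

theorem statement12 (p : ℕ) (hp : p.Prime) (hpodd : Odd p) (ζ : ℂ)
    (hζ : IsPrimitiveRoot ζ p) (d : ℕ) :
    Module.finrank ℂ
        (invariants (Submonoid.closure ({tmat ζ, wmat} : Set (Matrix (Fin 2) (Fin 2) ℂ))) d) =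
      if d % 4 = 0 then d / (2 * p) + 1
      else if d % 4 = 2 then d / (2 * p)
      else 0 := by
  rcases Nat.even_or_odd' d with ⟨m, rfl | hd⟩
  · rw [Nat.mul_div_mul_left _ _ (by norm_num : 0 < 2)]
    rcases Nat.even_or_odd m with hm | hm
    · rw [if_pos (by obtain ⟨r, rfl⟩ := hm; omega)]
      exact even_case p hp hpodd ζ hζ m 0 _ (Or.inl ⟨hm, rfl⟩) rfl
    · rw [if_neg (by obtain ⟨r, rfl⟩ := hm; omega), if_pos (by obtain ⟨r, rfl⟩ := hm; omega)]
      exact even_case p hp hpodd ζ hζ m 1 _ (Or.inr ⟨hm, rfl⟩) rfl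
  · rw [if_neg (by omega), if_neg (by omega), odd_case ζ d ⟨m, hd⟩]
    simp
end
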